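/- arXiv:2102.07346 — 2 statements merged into one kernel-verified Lean document; each statement's English description precedes it below -/
import Mathlib

section
/- For every A ∈ ℝ^{m×m} and γ ∈ (0,1), the operator 1-norm of the inverse of I_m − γσ(A) equals exactly 1/(1−γ): both ‖(I_m − γσ(A))^{-1}‖₁ ≤ 1/(1−γ) and ‖(I_m − γσ(A))^{-1}‖₁ ≥ 1/(1−γ) hold. -/
noncomputable section

/-- Column-wise softmax: `σ(A) i j = exp (A i j) / ∑ k, exp (A k j)`. -/
def softmax {m : ℕ} (A : Matrix (Fin m) (Fin m) ℝ) : Matrix (Fin m) (Fin m) ℝ :=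
  Matrix.of fun i j => Real.exp (A i j) / ∑ k, Real.exp (A k j)

/-- Operator norm induced by the vector 1-norm: maximum absolute column sum. -/
def opNorm1 {a b : ℕ} (M : Matrix (Fin a) (Fin b) ℝ) : ℝ :=
  ⨆ j, ∑ i, |M i j|

namespace Matrix

variable {n : Type*} [Fintype n] {S : Matrix n n ℝ} {c : ℝ}

theorem sum_abs_mul_le_of_sum_col_eq_one {p : Type*} (hS : ∀ i j, 0 ≤ S i j)
    (hsum : ∀ j, ∑ i, S i j = 1) (N : Matrix n p ℝ) (j : p) :
    ∑ i, |(S * N) i j| ≤ ∑ i, |N i j| := by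
  calc ∑ i, |(S * N) i j| ≤ ∑ i, ∑ k, S i k * |N k j| := by
        refine Finset.sum_le_sum fun i _ => ?_
        rw [mul_apply]
        refine (Finset.abs_sum_le_sum_abs _ _).trans_eq ?_
        simp only [abs_mul, abs_of_nonneg (hS i _)]
    _ = ∑ k, |N k j| := by
        rw [Finset.sum_comm]
        simp only [← Finset.sum_mul, hsum, one_mul]

variable [DecidableEq n]

theorem isUnit_det_one_sub_smul_of_sum_col_eq_one (hS : ∀ i j, 0 ≤ S i j)
    (hsum : ∀ j, ∑ i, S i j = 1) (hc0 : 0 ≤ c) (hc1 : c < 1) :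
    IsUnit (1 - c • S).det := by
  refine isUnit_iff_ne_zero.mpr (det_ne_zero_of_sum_col_lt_diag fun k => ?_)
  have hk : S k k + ∑ i ∈ Finset.univ.erase k, S i k = 1 := by
    rw [Finset.add_sum_erase _ (fun i => S i k) (Finset.mem_univ k), hsum]
  have hoff : ∑ i ∈ Finset.univ.erase k, ‖(1 - c • S) i k‖ =
      c * ∑ i ∈ Finset.univ.erase k, S i k := by
    rw [Finset.mul_sum]
    refine Finset.sum_congr rfl fun i hi => ?_
    simp [one_apply_ne (Finset.ne_of_mem_erase hi), abs_of_nonneg hc0, abs_of_nonneg (hS i k)]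
  have hdiag : 1 - c * S k k ≤ ‖(1 - c • S) k k‖ := by
    simpa using le_abs_self (1 - c * S k k)
  rw [hoff]
  refine lt_of_lt_of_le ?_ hdiag
  linear_combination hc1 + c * hk

theorem sum_abs_inv_one_sub_smul_le (hS : ∀ i j, 0 ≤ S i j)
    (hsum : ∀ j, ∑ i, S i j = 1) (hc0 : 0 ≤ c) (hc1 : c < 1) (j : n) :
    ∑ i, |(1 - c • S)⁻¹ i j| ≤ 1 / (1 - c) := by
  have hinv := mul_nonsing_inv _ (isUnit_det_one_sub_smul_of_sum_col_eq_one hS hsum hc0 hc1)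
  set N := (1 - c • S)⁻¹
  have hN : N = 1 + c • (S * N) := by
    rw [sub_mul, one_mul, smul_mul_assoc] at hinv
    rw [← hinv, sub_add_cancel]
  have hbound : ∑ i, |N i j| ≤ 1 + c * ∑ i, |N i j| :=
    calc ∑ i, |N i j| = ∑ i, |(1 : Matrix n n ℝ) i j + c * (S * N) i j| :=
          Finset.sum_congr rfl fun i _ => congrArg _ (congrFun (congrFun hN i) j)
      _ ≤ ∑ i, (|(1 : Matrix n n ℝ) i j| + c * |(S * N) i j|) := by
          refine Finset.sum_le_sum fun i _ => (abs_add_le _ _).trans_eq ?_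
          rw [abs_mul, abs_of_nonneg hc0]
      _ = 1 + c * ∑ i, |(S * N) i j| := by
          rw [Finset.sum_add_distrib, Finset.mul_sum]
          simp [one_apply, apply_ite abs]
      _ ≤ 1 + c * ∑ i, |N i j| := by
          gcongr 1 + c * ?_
          exact sum_abs_mul_le_of_sum_col_eq_one hS hsum N j
  rw [le_div_iff₀ (sub_pos.mpr hc1)]
  linarith

theorem sum_inv_one_sub_smul_eq (hS : ∀ i j, 0 ≤ S i j)
    (hsum : ∀ j, ∑ i, S i j = 1) (hc0 : 0 ≤ c) (hc1 : c < 1) (j : n) :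
    ∑ i, (1 - c • S)⁻¹ i j = 1 / (1 - c) := by
  have hinv := mul_nonsing_inv _ (isUnit_det_one_sub_smul_of_sum_col_eq_one hS hsum hc0 hc1)
  have hone : (1 : n → ℝ) ᵥ* (1 - c • S) = (1 - c) • (1 : n → ℝ) := by
    ext k
    simp [vecMul, dotProduct, Finset.sum_sub_distrib, ← Finset.mul_sum, hsum, one_apply]
  have hmul := congrArg (fun M => ((1 : n → ℝ) ᵥ* M) j) hinv
  simp only [← vecMul_vecMul, hone, smul_vecMul, vecMul_one] at hmul
  rw [eq_div_iff (sub_pos.mpr hc1).ne', mul_comm]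
  simpa [vecMul, dotProduct] using hmul

end Matrix

theorem softmax_nonneg {m : ℕ} (A : Matrix (Fin m) (Fin m) ℝ) (i j : Fin m) :
    0 ≤ softmax A i j :=
  div_nonneg (Real.exp_pos _).le (Finset.sum_nonneg fun _ _ => (Real.exp_pos _).le)

theorem sum_softmax {m : ℕ} (A : Matrix (Fin m) (Fin m) ℝ) (j : Fin m) :
    ∑ i, softmax A i j = 1 := by
  simp only [softmax, Matrix.of_apply, ← Finset.sum_div]
  exact div_self (Finset.sum_pos (fun _ _ => Real.exp_pos _) ⟨j, Finset.mem_univ j⟩).ne'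

/-- `‖(I - γσ(A))⁻¹‖₁ = 1/(1-γ)`, stated as the two inequalities
`‖(I - γσ(A))⁻¹‖₁ ≤ 1/(1-γ)` and `‖(I - γσ(A))⁻¹‖₁ ≥ 1/(1-γ)`. -/
theorem opNorm1_inv_one_sub_gamma_softmax {m : ℕ} (hm : 0 < m)
    (A : Matrix (Fin m) (Fin m) ℝ) (γ : ℝ) (hγ0 : 0 < γ) (hγ1 : γ < 1) :
    opNorm1 ((1 - γ • softmax A)⁻¹) ≤ 1 / (1 - γ) ∧
    1 / (1 - γ) ≤ opNorm1 ((1 - γ • softmax A)⁻¹) := by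
  have : Nonempty (Fin m) := ⟨⟨0, hm⟩⟩
  refine ⟨ciSup_le fun j => Matrix.sum_abs_inv_one_sub_smul_le (softmax_nonneg A)
    (sum_softmax A) hγ0.le hγ1 j, ?_⟩
  rw [← Matrix.sum_inv_one_sub_smul_eq (softmax_nonneg A) (sum_softmax A) hγ0.le hγ1 ⟨0, hm⟩]
  exact (Finset.sum_le_sum fun i _ => le_abs_self _).trans
    (le_ciSup (f := fun j => ∑ i, |(1 - γ • softmax A)⁻¹ i j|) (Set.finite_range _).bddAbove _)

end
end

section
/- Let m, m_y be positive integers, γ ∈ ℝ, U ∈ ℝ^{m×m} invertible, Z ∈ ℝ^{m_y×m}, and J_1,…,J_m ∈ ℝ^{m×m} arbitrary. Then the matrix D := Σ_{k=1}^m [(U^{-T})_{*k}(U^{-1})_{k*}] ⊗ (I_{m_y} + γ² Z J_k J_kᵀ Zᵀ) ∈ ℝ^{m_y m × m_y m} is symmetric positive definite, where (U^{-T})_{*k} denotes the k-th column of (U^{-1})ᵀ, (U^{-1})_{k*} denotes the k-th row of U^{-1}, and ⊗ denotes the Kronecker product. In particular D equals [U^{-T}U^{-1} ⊗ I_{m_y}]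 plus a positive semidefinite matrix. -/
open scoped Kronecker
open Matrix

noncomputable section

/-- The matrix `D = ∑ₖ [(U⁻ᵀ)_{*k}(U⁻¹)_{k*}] ⊗ (I_{m_y} + γ² Z Jₖ Jₖᵀ Zᵀ)`. -/
def Dmat {m my : ℕ} (γ : ℝ) (U : Matrix (Fin m) (Fin m) ℝ)
    (Z : Matrix (Fin my) (Fin m) ℝ) (J : Fin m → Matrix (Fin m) (Fin m) ℝ) :
    Matrix (Fin m × Fin my) (Fin m × Fin my) ℝ :=
  ∑ k : Fin m, (Matrix.vecMulVec (fun i => U⁻¹ k i) (fun j => U⁻¹ k j)) ⊗ₖ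
    ((1 : Matrix (Fin my) (Fin my) ℝ) + γ ^ 2 • (Z * J k * (J k)ᵀ * Zᵀ))

theorem sum_vecMulVec_row_eq_transpose_mul_self {m n R : Type*} [Fintype m] [CommSemiring R]
    (A : Matrix m n R) :
    ∑ k, Matrix.vecMulVec (fun i => A k i) (fun j => A k j) = Aᵀ * A := by
  ext i j
  simp [Matrix.sum_apply, Matrix.mul_apply, Matrix.vecMulVec_apply]

theorem Dmat_eq_add {m my : ℕ} (γ : ℝ) (U : Matrix (Fin m) (Fin m) ℝ)
    (Z : Matrix (Fin my) (Fin m) ℝ) (J : Fin m → Matrix (Fin m) (Fin m) ℝ) :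
    Dmat γ U Z J = ((U⁻¹)ᵀ * U⁻¹) ⊗ₖ (1 : Matrix (Fin my) (Fin my) ℝ) +
      ∑ k : Fin m, (Matrix.vecMulVec (fun i => U⁻¹ k i) (fun j => U⁻¹ k j)) ⊗ₖ
        (γ ^ 2 • (Z * J k * (J k)ᵀ * Zᵀ)) := by
  rw [← sum_vecMulVec_row_eq_transpose_mul_self]
  ext i j
  simp only [Dmat, Matrix.kronecker_add, Finset.sum_add_distrib, Matrix.add_apply,
    Matrix.sum_apply, Matrix.kroneckerMap_apply, Finset.sum_mul]

theorem posSemidef_sum_vecMulVec_kronecker {m my : ℕ} (γ : ℝ) (A : Matrix (Fin m) (Fin m) ℝ)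
    (Z : Matrix (Fin my) (Fin m) ℝ) (J : Fin m → Matrix (Fin m) (Fin m) ℝ) :
    (∑ k : Fin m, (Matrix.vecMulVec (fun i => A k i) (fun j => A k j)) ⊗ₖ
      (γ ^ 2 • (Z * J k * (J k)ᵀ * Zᵀ))).PosSemidef := by
  refine Matrix.posSemidef_sum _ fun k _ => Matrix.PosSemidef.kronecker ?_ ?_
  · simpa using Matrix.posSemidef_vecMulVec_self_star (fun i => A k i)
  · have h := Matrix.posSemidef_self_mul_conjTranspose (Z * J k)
    rw [Matrix.conjTranspose_eq_transpose_of_trivial, Matrix.transpose_mul,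
      ← Matrix.mul_assoc] at h
    exact h.smul (sq_nonneg γ)

theorem posDef_transpose_mul_self_of_isUnit {n : Type*} [Fintype n] [DecidableEq n]
    {A : Matrix n n ℝ} (hA : IsUnit A) : (Aᵀ * A).PosDef := by
  rw [← Matrix.conjTranspose_eq_transpose_of_trivial]
  exact Matrix.PosDef.conjTranspose_mul_self A (Matrix.mulVec_injective_of_isUnit hA)

/-- for any invertible `U ∈ ℝ^{m×m}`, any `Z ∈ ℝ^{m_y×m}`, any `γ ∈ ℝ` and
arbitrary `J₁,…,Jₘ ∈ ℝ^{m×m}`, the matrix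
`D = ∑ₖ [(U⁻ᵀ)_{*k}(U⁻¹)_{k*}] ⊗ (I + γ² Z Jₖ Jₖᵀ Zᵀ)` is symmetric positive definite;
in particular it is `[U⁻ᵀU⁻¹ ⊗ I_{m_y}]` plus a positive semidefinite matrix. -/
theorem Dmat_posDef {m my : ℕ} (hm : 0 < m) (hmy : 0 < my) (γ : ℝ)
    (U : Matrix (Fin m) (Fin m) ℝ) (hU : IsUnit U)
    (Z : Matrix (Fin my) (Fin m) ℝ) (J : Fin m → Matrix (Fin m) (Fin m) ℝ) :
    (Dmat γ U Z J).PosDef ∧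
    ∃ P : Matrix (Fin m × Fin my) (Fin m × Fin my) ℝ, P.PosSemidef ∧
      Dmat γ U Z J = ((U⁻¹)ᵀ * U⁻¹) ⊗ₖ (1 : Matrix (Fin my) (Fin my) ℝ) + P := by
  have hP := posSemidef_sum_vecMulVec_kronecker γ U⁻¹ Z J
  refine ⟨?_, _, hP, Dmat_eq_add γ U Z J⟩
  rw [Dmat_eq_add]
  have hUinv : IsUnit U⁻¹ := Matrix.isUnit_nonsing_inv_iff.mpr hU
  exact ((posDef_transpose_mul_self_of_isUnit hUinv).kronecker Matrix.PosDef.one).add_posSemidef hP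

end
end
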